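/- arXiv:1508.01923 — 2 statements merged into one kernel-verified Lean document; each statement's English description precedes it below -/
import Mathlib

section
/- For every integer n ≥ −1, every i ∈ Fin d, j ∈ ℕ and every k ∈ ℤ, one has L_λ(n) ∘ a_{i,j}(k) − a_{i,j}(k) ∘ L_λ(n) = −k·a_{i,j}(n+k) as ℂ-linear endomorphisms of R, where the operators a_{i,j}(k) are those of the evaluation module at c = 0 (so a_{i,j}(0) = λ(i)·id_R if j = 0 and a_{i,j}(0) = 0 if j > 0). (This is the commutator relation underlying equation (4.5) of Theorem 4.3 for the module W(λ,0,l).) -/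
open MvPolynomial

/-- Value of the operator `L(n)` on the monomial `X^e`, in the polynomial realization of `M(l)`:
`L(n) = (l/2)·∑_{i,j} ∑_{m=1}^{n-1} m(n-m)·∂_{i,j,m}∘∂_{i,j,n-m}
        + ∑_{i,j} ∑_{m ≥ max(1,n+1)} m·X_{i,j,m-n}∘∂_{i,j,m}`;
on a fixed monomial only finitely many summands are nonzero, namely those whose rightmost
derivative variable lies in the support of `e`. -/
noncomputable def LnMono (d : ℕ) (l : ℂ) (n : ℤ)
    (e : (Fin d × ℕ × ℕ+) →₀ ℕ) : MvPolynomial (Fin d × ℕ × ℕ+) ℂ :=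
  (l / 2) • (∑ v ∈ e.support,
      if h : ((v.2.2 : ℕ) : ℤ) < n then
        (((n - ((v.2.2 : ℕ) : ℤ)) * ((v.2.2 : ℕ) : ℤ) : ℤ) : ℂ) •
          pderiv (((v.1, v.2.1, ⟨(n - ((v.2.2 : ℕ) : ℤ)).toNat, by omega⟩) : Fin d × ℕ × ℕ+))
            (pderiv v (monomial e (1 : ℂ)))
      else 0)
  + ∑ v ∈ e.support,
      if h : n < ((v.2.2 : ℕ) : ℤ) then
        (((v.2.2 : ℕ) : ℤ) : ℂ) •
          ((X (v.1, v.2.1, (⟨(((v.2.2 : ℕ) : ℤ) - n).toNat, by omega⟩ : ℕ+)) : MvPolynomial (Fin d × ℕ × ℕ+) ℂ) *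
            pderiv v (monomial e (1 : ℂ)))
      else 0

/-- The operator `L(n)` (for any `n : ℤ`; only `n ≥ -1` is used) on the polynomial
realization `R = MvPolynomial (Fin d × ℕ × ℕ+) ℂ` of `M(l)`, defined on the monomial basis. -/
noncomputable def Ln (d : ℕ) (l : ℂ) (n : ℤ) :
    Module.End ℂ (MvPolynomial (Fin d × ℕ × ℕ+) ℂ) :=
  (basisMonomials (Fin d × ℕ × ℕ+) ℂ).constr ℂ (LnMono d l n)


/-- The operators `L_λ(n)` on the module `W(λ,0,l)` (evaluation at `c = 0`):
`L_λ(n) = L(n) + n·∑_i λ(i)·∂_{i,0,n}` for `n ≥ 1`,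
`L_λ(0) = L(0) + ((∑_i λ(i)²)/(2l))·id`, and
`L_λ(-1) = L(-1) + (1/l)·∑_i λ(i)·X_{i,0,1}`. -/
noncomputable def Llam (d : ℕ) (l : ℂ) (lam : Fin d → ℂ) (n : ℤ) :
    Module.End ℂ (MvPolynomial (Fin d × ℕ × ℕ+) ℂ) :=
  if hn : 0 < n then
    Ln d l n + (n : ℂ) • ∑ i : Fin d, lam i •
      (pderiv (((i, 0, ⟨n.toNat, by omega⟩) : Fin d × ℕ × ℕ+))).toLinearMap
  else if hn0 : n = 0 then
    Ln d l 0 + ((∑ i : Fin d, lam i ^ 2) / (2 * l)) •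
      (1 : Module.End ℂ (MvPolynomial (Fin d × ℕ × ℕ+) ℂ))
  else
    Ln d l n + l⁻¹ • ∑ i : Fin d, lam i •
      LinearMap.mulLeft ℂ (X ((i, 0, 1) : Fin d × ℕ × ℕ+))

/-- The operators `a_{i,j}(k)` of the polynomial realization of the `ĥ[t]`-module
`W(λ,0,l) = M(l) ⊗ V(λ,0)` (evaluation at `c = 0`): `a_{i,j}(k) = k·l·∂_{i,j,k}` for `k > 0`,
`a_{i,j}(0) = λ(i)·id` if `j = 0` and `0` if `j > 0`, and `a_{i,j}(k) = X_{i,j,-k}` for `k < 0`. -/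
noncomputable def aOpLam (d : ℕ) (l : ℂ) (lam : Fin d → ℂ) (i : Fin d) (j : ℕ) (k : ℤ) :
    Module.End ℂ (MvPolynomial (Fin d × ℕ × ℕ+) ℂ) :=
  if hk : 0 < k then
    ((k : ℂ) * l) • (pderiv (((i, j, ⟨k.toNat, by omega⟩) : Fin d × ℕ × ℕ+))).toLinearMap
  else if hk0 : k = 0 then
    (if j = 0 then lam i else 0) • (1 : Module.End ℂ (MvPolynomial (Fin d × ℕ × ℕ+) ℂ))
  else
    LinearMap.mulLeft ℂ (X ((i, j, ⟨(-k).toNat, by omega⟩) : Fin d × ℕ × ℕ+))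


/-- total version of the partial derivative -/
noncomputable def Dop (d : ℕ) (i : Fin d) (j : ℕ) (k : ℤ) :
    Module.End ℂ (MvPolynomial (Fin d × ℕ × ℕ+) ℂ) :=
  if hk : 0 < k then
    (pderiv (((i, j, ⟨k.toNat, by omega⟩) : Fin d × ℕ × ℕ+))).toLinearMap else 0

/-- total version of the multiplication by a variable -/
noncomputable def Xop (d : ℕ) (i : Fin d) (j : ℕ) (k : ℤ) :
    Module.End ℂ (MvPolynomial (Fin d × ℕ × ℕ+) ℂ) :=
  if hk : 0 < k then
    LinearMap.mulLeft ℂ (X ((i, j, ⟨k.toNat, by omega⟩) : Fin d × ℕ × ℕ+)) else 0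

/-- the summand of `L(n)` attached to a variable -/
noncomputable def Tv (d : ℕ) (l : ℂ) (n : ℤ) (v : Fin d × ℕ × ℕ+) :
    Module.End ℂ (MvPolynomial (Fin d × ℕ × ℕ+) ℂ) :=
  ((l / 2) * ((n - ((v.2.2 : ℕ) : ℤ)) * ((v.2.2 : ℕ) : ℤ) : ℤ)) •
    (Dop d v.1 v.2.1 (n - ((v.2.2 : ℕ) : ℤ)) * Dop d v.1 v.2.1 ((v.2.2 : ℕ) : ℤ))
  + (((v.2.2 : ℕ) : ℤ) : ℂ) •
    (Xop d v.1 v.2.1 (((v.2.2 : ℕ) : ℤ) - n) * Dop d v.1 v.2.1 ((v.2.2 : ℕ) : ℤ))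

theorem Dop_coe (d : ℕ) (v : Fin d × ℕ × ℕ+) :
    Dop d v.1 v.2.1 ((v.2.2 : ℕ) : ℤ) = (pderiv v).toLinearMap := by
  have h : (0 : ℤ) < ((v.2.2 : ℕ) : ℤ) := by exact_mod_cast v.2.2.pos
  rw [Dop, dif_pos h]
  rfl

theorem Xop_coe (d : ℕ) (v : Fin d × ℕ × ℕ+) :
    Xop d v.1 v.2.1 ((v.2.2 : ℕ) : ℤ) = LinearMap.mulLeft ℂ (X v) := by
  have h : (0 : ℤ) < ((v.2.2 : ℕ) : ℤ) := by exact_mod_cast v.2.2.pos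
  rw [Xop, dif_pos h]
  rfl

theorem Tv_zero (d : ℕ) (l : ℂ) (n : ℤ) (v : Fin d × ℕ × ℕ+)
    (e : (Fin d × ℕ × ℕ+) →₀ ℕ) (c : ℂ) (hv : v ∉ e.support) :
    Tv d l n v (monomial e c) = 0 := by
  have h0 : e v = 0 := by simpa using hv
  have : pderiv v (monomial e c) = 0 := by
    rw [pderiv_monomial, h0]; simp
  simp [Tv, Dop_coe, this]

theorem Ln_monomial (d : ℕ) (l : ℂ) (n : ℤ) (e : (Fin d × ℕ × ℕ+) →₀ ℕ) (c : ℂ)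
    (S : Finset (Fin d × ℕ × ℕ+)) (hS : e.support ⊆ S) :
    Ln d l n (monomial e c) = ∑ v ∈ S, Tv d l n v (monomial e c) := by
  rw [← Finset.sum_subset hS (fun v _ hv => Tv_zero d l n v e c hv)]
  have hc : (monomial e c : MvPolynomial (Fin d × ℕ × ℕ+) ℂ) = c • monomial e 1 := by
    simp [smul_monomial]
  rw [hc]
  simp only [map_smul]
  rw [← Finset.smul_sum]
  congr 1
  have h1 : (monomial e (1:ℂ) : MvPolynomial (Fin d × ℕ × ℕ+) ℂ)
      = basisMonomials (Fin d × ℕ × ℕ+) ℂ e := by simp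
  rw [h1, Ln, Module.Basis.constr_basis, ← h1, LnMono, Finset.smul_sum, ← Finset.sum_add_distrib]
  refine Finset.sum_congr rfl fun v _ => ?_
  rw [Tv, LinearMap.add_apply, LinearMap.smul_apply, LinearMap.smul_apply, Module.End.mul_apply,
    Module.End.mul_apply, Dop_coe]
  congr 1
  · rw [mul_smul]
    congr 1
    by_cases h : ((v.2.2 : ℕ) : ℤ) < n
    · rw [dif_pos h, Dop, dif_pos (by omega)]; rfl
    · rw [dif_neg h, Dop, dif_neg (by omega)]; simp
  · by_cases h : n < ((v.2.2 : ℕ) : ℤ)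
    · rw [dif_pos h, Xop, dif_pos (by omega)]; rfl
    · rw [dif_neg h, Xop, dif_neg (by omega)]; simp

theorem D_comm (d : ℕ) (i i' : Fin d) (j j' : ℕ) (k k' : ℤ) :
    Dop d i j k * Dop d i' j' k' = Dop d i' j' k' * Dop d i j k := by
  unfold Dop
  split_ifs
  · rename_i h1 h2
    have : ⁅pderiv (R := ℂ) (((i, j, ⟨k.toNat, by omega⟩) : Fin d × ℕ × ℕ+)),
        pderiv (R := ℂ) (((i', j', ⟨k'.toNat, by omega⟩) : Fin d × ℕ × ℕ+))⁆ = 0 := by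
      apply MvPolynomial.derivation_ext
      intro v
      rw [Derivation.commutator_apply, pderiv_X, pderiv_X]
      simp only [Pi.single_apply]
      split_ifs <;> simp
    refine LinearMap.ext fun f => ?_
    have h := DFunLike.congr_fun this f
    rw [Derivation.commutator_apply] at h
    exact sub_eq_zero.1 h
  all_goals simp

theorem X_comm (d : ℕ) (i i' : Fin d) (j j' : ℕ) (k k' : ℤ) :
    Xop d i j k * Xop d i' j' k' = Xop d i' j' k' * Xop d i j k := by
  unfold Xop
  split_ifs
  · refine LinearMap.ext fun f => ?_
    simp only [Module.End.mul_apply, LinearMap.mulLeft_apply]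
    ring
  all_goals simp

theorem DX_aux (d : ℕ) (v w : Fin d × ℕ × ℕ+) (h : w ≠ v) :
    ((pderiv v).toLinearMap * LinearMap.mulLeft ℂ (X w) :
      Module.End ℂ (MvPolynomial (Fin d × ℕ × ℕ+) ℂ)) =
      LinearMap.mulLeft ℂ (X w) * (pderiv v).toLinearMap + (0 : ℂ) • 1 := by
  refine LinearMap.ext fun f => ?_
  have := pderiv_X_of_ne (R := ℂ) h
  rw [Module.End.mul_apply, LinearMap.mulLeft_apply, Derivation.coeFn_coe,
    Derivation.leibniz, this]
  simp

theorem DX_comm (d : ℕ) (i i' : Fin d) (j j' : ℕ) (k k' : ℤ) :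
    Dop d i j k * Xop d i' j' k' = Xop d i' j' k' * Dop d i j k +
      (if i = i' ∧ j = j' ∧ k = k' ∧ 0 < k then (1 : ℂ) else 0) • 1 := by
  unfold Xop Dop
  split_ifs with h1 h2 h3 h3 h3
  · obtain ⟨rfl, rfl, rfl, _⟩ := h3
    refine LinearMap.ext fun f => ?_
    simp [Derivation.leibniz, add_comm]
  · apply DX_aux
    intro h
    have a := congrArg Prod.fst h
    have b := congrArg (fun x => x.2.1) h
    have this := congrArg (fun x => PNat.val x.2.2) h
    simp only [PNat.mk_coe] at a b this
    exact h3 ⟨a.symm, b.symm, by omega, h1⟩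
  all_goals first | (exfalso; omega) | simp

theorem alg_X {A : Type*} [Ring A] [Algebra ℂ A] (D1 D2 X Y : A) (a b c1 c2 : ℂ)
    (h1 : D1 * X = X * D1 + c1 • 1) (h2 : D2 * X = X * D2 + c2 • 1) (h3 : Y * X = X * Y) :
    (a • (D1 * D2) + b • (Y * D2)) * X - X * (a • (D1 * D2) + b • (Y * D2)) =
      (a * c1) • D2 + (a * c2) • D1 + (b * c2) • Y := by
  have e1 : D1 * D2 * X = X * (D1 * D2) + c1 • D2 + c2 • D1 := by
    rw [mul_assoc, h2, mul_add, ← mul_assoc, h1, add_mul]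
    simp [mul_assoc]
  have e2 : Y * D2 * X = X * (Y * D2) + c2 • Y := by
    rw [mul_assoc, h2, mul_add, ← mul_assoc, h3]
    simp [mul_assoc]
  rw [add_mul, mul_add, smul_mul_assoc, smul_mul_assoc, e1, e2, mul_smul_comm, mul_smul_comm]
  module

theorem alg_D {A : Type*} [Ring A] [Algebra ℂ A] (D1 D2 E Y : A) (a b c : ℂ)
    (h1 : D1 * E = E * D1) (h2 : D2 * E = E * D2) (h3 : E * Y = Y * E + c • 1) :
    (a • (D1 * D2) + b • (Y * D2)) * E - E * (a • (D1 * D2) + b • (Y * D2)) =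
      (-(b * c)) • D2 := by
  have e1 : D1 * D2 * E = E * (D1 * D2) := by
    rw [mul_assoc, h2, ← mul_assoc, h1, mul_assoc]
  have e2 : E * (Y * D2) = Y * D2 * E + c • D2 := by
    rw [← mul_assoc, h3, add_mul, mul_assoc, ← h2]
    simp [mul_assoc]
  rw [add_mul, mul_add, smul_mul_assoc, smul_mul_assoc, e1, mul_smul_comm, mul_smul_comm, e2]
  module

theorem Tv_X (d : ℕ) (l : ℂ) (n : ℤ) (w v : Fin d × ℕ × ℕ+) :
    Tv d l n v * Xop d w.1 w.2.1 ((w.2.2 : ℕ) : ℤ) - Xop d w.1 w.2.1 ((w.2.2 : ℕ) : ℤ) * Tv d l n v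
      = (if v = w then ((l / 2) * (w.2.2 : ℕ) * (n - (w.2.2 : ℕ))) • Dop d w.1 w.2.1 (n - (w.2.2 : ℕ))
          + (((w.2.2 : ℕ) : ℂ)) • Xop d w.1 w.2.1 ((w.2.2 : ℕ) - n) else 0)
      + (if v.1 = w.1 ∧ v.2.1 = w.2.1 ∧ ((v.2.2 : ℕ) : ℤ) = n - (w.2.2 : ℕ) then
          ((l / 2) * (w.2.2 : ℕ) * (n - (w.2.2 : ℕ))) • Dop d w.1 w.2.1 (n - (w.2.2 : ℕ)) else 0) := by
  rw [Tv, alg_X _ _ _ _ _ _ _ _ (DX_comm _ _ _ _ _ _ _) (DX_comm _ _ _ _ _ _ _)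
    (X_comm _ _ _ _ _ _ _)]
  obtain ⟨i, j, p⟩ := w
  obtain ⟨i', j', q⟩ := v
  have hp := p.pos
  have hq := q.pos
  simp only [Prod.mk.injEq]
  by_cases hi : i' = i
  swap
  · simp [hi]
  by_cases hj : j' = j
  swap
  · simp [hj]
  subst hi hj
  have e1 : (((q : ℕ) : ℤ) = ((p : ℕ) : ℤ) ∧ (0 : ℤ) < ((q : ℕ) : ℤ)) ↔ q = p := by
    rw [← PNat.coe_inj]; omega
  have e2 : (n - ((q : ℕ) : ℤ) = ((p : ℕ) : ℤ) ∧ 0 < n - ((q : ℕ) : ℤ)) ↔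
      ((q : ℕ) : ℤ) = n - ((p : ℕ) : ℤ) := by omega
  simp only [true_and, e1, e2]
  have f1 : (if ((q : ℕ) : ℤ) = n - ((p : ℕ) : ℤ) then
          ((l / 2) * (p : ℕ) * (n - (p : ℕ))) • Dop d i' j' (n - (p : ℕ)) else 0) =
      (l / 2 * ((n - ((q : ℕ) : ℤ)) * ((q : ℕ) : ℤ) : ℤ) *
        (if ((q : ℕ) : ℤ) = n - ((p : ℕ) : ℤ) then (1 : ℂ) else 0)) • Dop d i' j' ((q : ℕ) : ℤ) := by
    split_ifs with h
    · rw [h]; congr 1; push_cast; ring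
    · simp
  rw [f1]
  by_cases h : q = p
  · subst h
    rw [if_pos rfl, if_pos rfl]
    push_cast
    module
  · rw [if_neg h, if_neg h]
    push_cast
    module

theorem Ln_X (d : ℕ) (l : ℂ) (n : ℤ) (i : Fin d) (j : ℕ) (p : ℤ) (hp : 0 < p) :
    Ln d l n * Xop d i j p - Xop d i j p * Ln d l n =
      (l * p * (n - p)) • Dop d i j (n - p) + (p : ℂ) • Xop d i j (p - n) := by
  classical
  obtain ⟨q, rfl⟩ : ∃ q : ℕ+, p = ((q : ℕ) : ℤ) := ⟨⟨p.toNat, by omega⟩, by simp; omega⟩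
  refine (basisMonomials _ ℂ).ext fun e => ?_
  rw [coe_basisMonomials]
  obtain ⟨w, hw⟩ : ∃ w : Fin d × ℕ × ℕ+, w = (i, j, q) := ⟨_, rfl⟩
  obtain ⟨w', hw'⟩ : ∃ w' : Fin d × ℕ × ℕ+, (0 < n - ((q : ℕ) : ℤ) →
      w'.1 = i ∧ w'.2.1 = j ∧ ((w'.2.2 : ℕ) : ℤ) = n - ((q : ℕ) : ℤ)) := by
    by_cases h : 0 < n - ((q : ℕ) : ℤ)
    · refine ⟨(i, j, ⟨(n - ((q : ℕ) : ℤ)).toNat, by omega⟩), fun _ => ⟨rfl, rfl, ?_⟩⟩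
      simp only [PNat.mk_coe]
      omega
    · exact ⟨w, fun h1 => absurd h1 h⟩
  obtain ⟨S, hS⟩ : ∃ S : Finset (Fin d × ℕ × ℕ+), S = insert w (insert w' e.support) := ⟨_, rfl⟩
  have hX : Xop d i j ((q : ℕ) : ℤ) (monomial e 1) = monomial (Finsupp.single w 1 + e) 1 := by
    have := Xop_coe d w
    rw [hw] at this
    rw [this, hw, LinearMap.mulLeft_apply, X, monomial_mul, one_mul]
  rw [LinearMap.sub_apply, Module.End.mul_apply, Module.End.mul_apply, hX,
    Ln_monomial d l n _ _ S, Ln_monomial d l n e _ S, ← hX, map_sum, ← Finset.sum_sub_distrib]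
  rotate_left
  · rw [hS]; intro x hx; simp only [Finset.mem_insert]; tauto
  · rw [hS]; intro x hx
    have := Finsupp.support_add hx
    simp only [Finset.mem_insert]
    rw [Finset.mem_union] at this
    rcases this with h | h
    · have := Finsupp.support_single_subset h
      simp at this; tauto
    · tauto
  have key := fun v => LinearMap.congr_fun (Tv_X d l n w v) (monomial e (1 : ℂ))
  rw [hw] at key
  simp only [LinearMap.sub_apply, Module.End.mul_apply] at key
  rw [Finset.sum_congr rfl fun v _ => key v]
  rw [← LinearMap.sum_apply]
  congr 1
  rw [Finset.sum_add_distrib, Finset.sum_ite_eq', if_pos (by rw [hS, hw]; simp)]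
  have h2 : (∑ v ∈ S, if v.1 = i ∧ v.2.1 = j ∧ ((v.2.2 : ℕ) : ℤ) = n - (q : ℕ) then
          ((l / 2) * (q : ℕ) * (n - (q : ℕ))) • Dop d i j (n - (q : ℕ)) else 0)
      = ((l / 2) * (q : ℕ) * (n - (q : ℕ))) • Dop d i j (n - (q : ℕ)) := by
    by_cases h : 0 < n - ((q : ℕ) : ℤ)
    · have hv : ∀ v : Fin d × ℕ × ℕ+,
          (v.1 = i ∧ v.2.1 = j ∧ ((v.2.2 : ℕ) : ℤ) = n - (q : ℕ)) ↔ v = w' := by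
        intro v
        obtain ⟨a, b, c⟩ := hw' h
        rw [Prod.ext_iff, Prod.ext_iff, ← PNat.coe_inj, a, b, ← c, Nat.cast_inj]
      simp only [hv]
      rw [Finset.sum_ite_eq', if_pos (by rw [hS]; simp)]
    · rw [Dop, dif_neg h]; simp
  rw [h2]
  push_cast
  module

theorem Tv_D (d : ℕ) (l : ℂ) (n : ℤ) (w v : Fin d × ℕ × ℕ+) :
    Tv d l n v * Dop d w.1 w.2.1 ((w.2.2 : ℕ) : ℤ) - Dop d w.1 w.2.1 ((w.2.2 : ℕ) : ℤ) * Tv d l n v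
      = (if v.1 = w.1 ∧ v.2.1 = w.2.1 ∧ ((v.2.2 : ℕ) : ℤ) = (w.2.2 : ℕ) + n then
          (-((w.2.2 : ℕ) + n : ℂ)) • Dop d w.1 w.2.1 ((w.2.2 : ℕ) + n) else 0) := by
  rw [Tv, alg_D _ _ _ _ _ _ _ (D_comm _ _ _ _ _ _ _) (D_comm _ _ _ _ _ _ _)
    (DX_comm _ _ _ _ _ _ _)]
  obtain ⟨i, j, p⟩ := w
  obtain ⟨i', j', q⟩ := v
  have hp := p.pos
  have hq := q.pos
  simp only
  have e2 : (i = i' ∧ j = j' ∧ ((p : ℕ) : ℤ) = ((q : ℕ) : ℤ) - n ∧ (0 : ℤ) < ((p : ℕ) : ℤ)) ↔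
      (i' = i ∧ j' = j ∧ ((q : ℕ) : ℤ) = ((p : ℕ) : ℤ) + n) := by
    constructor
    · rintro ⟨a, b, c, _⟩; exact ⟨a.symm, b.symm, by omega⟩
    · rintro ⟨a, b, c⟩; exact ⟨a.symm, b.symm, by omega, by omega⟩
  simp only [e2]
  split_ifs with h
  · obtain ⟨rfl, rfl, h⟩ := h
    rw [h]; congr 1; push_cast; ring
  · simp

theorem Ln_D (d : ℕ) (l : ℂ) (n : ℤ) (i : Fin d) (j : ℕ) (p : ℤ) (hp : 0 < p) :
    Ln d l n * Dop d i j p - Dop d i j p * Ln d l n =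
      (-((p : ℂ) + n)) • Dop d i j (p + n) := by
  classical
  obtain ⟨q, rfl⟩ : ∃ q : ℕ+, p = ((q : ℕ) : ℤ) := ⟨⟨p.toNat, by omega⟩, by simp; omega⟩
  refine (basisMonomials _ ℂ).ext fun e => ?_
  rw [coe_basisMonomials]
  obtain ⟨w, hw⟩ : ∃ w : Fin d × ℕ × ℕ+, w = (i, j, q) := ⟨_, rfl⟩
  obtain ⟨w', hw'⟩ : ∃ w' : Fin d × ℕ × ℕ+, (0 < ((q : ℕ) : ℤ) + n →
      w'.1 = i ∧ w'.2.1 = j ∧ ((w'.2.2 : ℕ) : ℤ) = ((q : ℕ) : ℤ) + n) := by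
    by_cases h : 0 < ((q : ℕ) : ℤ) + n
    · refine ⟨(i, j, ⟨(((q : ℕ) : ℤ) + n).toNat, by omega⟩), fun _ => ⟨rfl, rfl, ?_⟩⟩
      simp only [PNat.mk_coe]
      omega
    · exact ⟨w, fun h1 => absurd h1 h⟩
  obtain ⟨S, hS⟩ : ∃ S : Finset (Fin d × ℕ × ℕ+), S = insert w' e.support := ⟨_, rfl⟩
  have hX : Dop d i j ((q : ℕ) : ℤ) (monomial e 1) =
      monomial (e - Finsupp.single w 1) (1 * (e w : ℂ)) := by
    have := Dop_coe d w
    rw [hw] at this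
    rw [this, hw, Derivation.coeFn_coe, pderiv_monomial]
  rw [LinearMap.sub_apply, Module.End.mul_apply, Module.End.mul_apply, hX,
    Ln_monomial d l n _ _ S, Ln_monomial d l n e _ S, ← hX, map_sum, ← Finset.sum_sub_distrib]
  rotate_left
  · rw [hS]; intro x hx; simp only [Finset.mem_insert]; tauto
  · rw [hS]; intro x hx
    have : e x ≠ 0 := by
      intro h0
      rw [Finsupp.mem_support_iff, Finsupp.tsub_apply, h0] at hx
      simp at hx
    simp [this]
  have key := fun v => LinearMap.congr_fun (Tv_D d l n w v) (monomial e (1 : ℂ))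
  rw [hw] at key
  simp only [LinearMap.sub_apply, Module.End.mul_apply] at key
  rw [Finset.sum_congr rfl fun v _ => key v]
  rw [← LinearMap.sum_apply]
  congr 1
  by_cases h : 0 < ((q : ℕ) : ℤ) + n
  · have hv : ∀ v : Fin d × ℕ × ℕ+,
        (v.1 = i ∧ v.2.1 = j ∧ ((v.2.2 : ℕ) : ℤ) = (q : ℕ) + n) ↔ v = w' := by
      intro v
      obtain ⟨a, b, c⟩ := hw' h
      rw [Prod.ext_iff, Prod.ext_iff, ← PNat.coe_inj, a, b, ← c, Nat.cast_inj]
    simp only [hv]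
    rw [Finset.sum_ite_eq', if_pos (by rw [hS]; simp)]
    push_cast
    rfl
  · rw [Dop, dif_neg h]; simp

theorem aOpLam_eq (d : ℕ) (l : ℂ) (lam : Fin d → ℂ) (i : Fin d) (j : ℕ) (k : ℤ) :
    aOpLam d l lam i j k = ((k : ℂ) * l) • Dop d i j k + Xop d i j (-k)
      + (if k = 0 ∧ j = 0 then lam i else 0) • 1 := by
  unfold aOpLam Dop Xop
  rcases lt_trichotomy k 0 with h | h | h
  · simp [h, h.ne, not_lt.2 h.le]
  · simp [h]
  · simp [h, h.ne', not_lt.2 h.le]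

theorem Llam_eq (d : ℕ) (l : ℂ) (lam : Fin d → ℂ) (n : ℤ) (hn : -1 ≤ n) :
    ∃ c : ℂ, Llam d l lam n = Ln d l n + (n : ℂ) • ∑ i : Fin d, lam i • Dop d i 0 n
      + (if n = -1 then l⁻¹ else 0) • ∑ i : Fin d, lam i • Xop d i 0 (-n) + c • 1 := by
  unfold Llam Dop Xop
  rcases lt_trichotomy n 0 with h | h | h
  · obtain rfl : n = -1 := by omega
    refine ⟨0, ?_⟩
    simp
  · refine ⟨(∑ i : Fin d, lam i ^ 2) / (2 * l), ?_⟩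
    subst h
    simp
  · refine ⟨0, ?_⟩
    have : n ≠ -1 := by omega
    simp [h, this]


theorem Dop_nonpos (d : ℕ) (i : Fin d) (j : ℕ) (k : ℤ) (hk : k ≤ 0) : Dop d i j k = 0 := by
  rw [Dop, dif_neg (by omega)]

theorem Xop_nonpos (d : ℕ) (i : Fin d) (j : ℕ) (k : ℤ) (hk : k ≤ 0) : Xop d i j k = 0 := by
  rw [Xop, dif_neg (by omega)]

theorem sumD_X (d : ℕ) (lam : Fin d → ℂ) (n : ℤ) (i : Fin d) (j : ℕ) (p : ℤ) :
    (∑ i' : Fin d, lam i' • Dop d i' 0 n) * Xop d i j p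
      - Xop d i j p * (∑ i' : Fin d, lam i' • Dop d i' 0 n)
      = (if j = 0 ∧ n = p ∧ 0 < n then lam i else 0) • 1 := by
  rw [Finset.sum_mul, Finset.mul_sum, ← Finset.sum_sub_distrib]
  have : ∀ i' : Fin d, (lam i' • Dop d i' 0 n) * Xop d i j p
      - Xop d i j p * (lam i' • Dop d i' 0 n) =
      if i' = i then (if j = 0 ∧ n = p ∧ 0 < n then lam i else 0) • 1 else 0 := by
    intro i'
    rw [smul_mul_assoc, mul_smul_comm, DX_comm, smul_add, add_sub_cancel_left]
    by_cases h : i' = i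
    · subst h
      simp [eq_comm (a := 0) (b := j)]
    · simp [h]
  rw [Finset.sum_congr rfl fun i' _ => this i']
  simp

theorem sumX_D (d : ℕ) (lam : Fin d → ℂ) (n : ℤ) (i : Fin d) (j : ℕ) (p : ℤ) :
    (∑ i' : Fin d, lam i' • Xop d i' 0 n) * Dop d i j p
      - Dop d i j p * (∑ i' : Fin d, lam i' • Xop d i' 0 n)
      = (-(if j = 0 ∧ p = n ∧ 0 < p then lam i else 0)) • 1 := by
  rw [Finset.sum_mul, Finset.mul_sum, ← Finset.sum_sub_distrib]
  have : ∀ i' : Fin d, (lam i' • Xop d i' 0 n) * Dop d i j p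
      - Dop d i j p * (lam i' • Xop d i' 0 n) =
      if i' = i then (-(if j = 0 ∧ p = n ∧ 0 < p then lam i else 0)) • 1 else 0 := by
    intro i'
    rw [smul_mul_assoc, mul_smul_comm, DX_comm, smul_add, sub_add_cancel_left]
    by_cases h : i' = i
    · subst h
      simp only [true_and]
      split_ifs
      · rw [one_smul]; module
      · simp
    · simp [h, Ne.symm h]
  rw [Finset.sum_congr rfl fun i' _ => this i']
  simp

theorem sumD_D (d : ℕ) (lam : Fin d → ℂ) (n : ℤ) (i : Fin d) (j : ℕ) (p : ℤ) :
    (∑ i' : Fin d, lam i' • Dop d i' 0 n) * Dop d i j p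
      - Dop d i j p * (∑ i' : Fin d, lam i' • Dop d i' 0 n) = 0 := by
  rw [Finset.sum_mul, Finset.mul_sum, ← Finset.sum_sub_distrib]
  refine Finset.sum_eq_zero fun i' _ => ?_
  rw [smul_mul_assoc, mul_smul_comm, D_comm, sub_self]

theorem sumX_X (d : ℕ) (lam : Fin d → ℂ) (n : ℤ) (i : Fin d) (j : ℕ) (p : ℤ) :
    (∑ i' : Fin d, lam i' • Xop d i' 0 n) * Xop d i j p
      - Xop d i j p * (∑ i' : Fin d, lam i' • Xop d i' 0 n) = 0 := by
  rw [Finset.sum_mul, Finset.mul_sum, ← Finset.sum_sub_distrib]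
  refine Finset.sum_eq_zero fun i' _ => ?_
  rw [smul_mul_assoc, mul_smul_comm, X_comm, sub_self]

theorem alg_smul {A : Type*} [Ring A] [Algebra ℂ A] (L B : A) (r : ℂ) :
    L * (r • B) - (r • B) * L = r • (L * B - B * L) := by
  rw [mul_smul_comm, smul_mul_assoc, smul_sub]

theorem alg_comm {A : Type*} [Ring A] [Algebra ℂ A] (L P Q B u v w : A) (a b c : ℂ)
    (h1 : L * B - B * L = u) (h2 : P * B - B * P = v) (h3 : Q * B - B * Q = w) :
    (L + a • P + b • Q + c • 1) * B - B * (L + a • P + b • Q + c • 1)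
      = u + a • v + b • w := by
  subst h1 h2 h3
  simp only [add_mul, mul_add, smul_mul_assoc, mul_smul_comm, one_mul, mul_one, smul_sub]
  abel

theorem Llam_zero (d : ℕ) (l : ℂ) (hl : l ≠ 0) (lam : Fin d → ℂ) (n : ℤ) (hn : -1 ≤ n)
    (i : Fin d) (j : ℕ) (k : ℤ) :
    Llam d l lam n * aOpLam d l lam i j k - aOpLam d l lam i j k * Llam d l lam n
      = (-(k : ℂ)) • aOpLam d l lam i j (n + k) := by
  obtain ⟨c, hc⟩ := Llam_eq d l lam n hn
  rcases lt_trichotomy k 0 with h | rfl | h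
  · have ha : aOpLam d l lam i j k = Xop d i j (-k) := by
      rw [aOpLam_eq, Dop_nonpos _ _ _ _ h.le]; simp [h.ne]
    rw [ha, hc, alg_comm _ _ _ _ _ _ _ _ _ _ (Ln_X d l n i j (-k) (by omega))
      (sumD_X d lam n i j (-k)) (sumX_X d lam (-n) i j (-k)), aOpLam_eq]
    have e1 : n - -k = n + k := by ring
    have e2 : -k - n = -(n + k) := by ring
    have e3 : (j = 0 ∧ n = -k ∧ 0 < n) ↔ (n + k = 0 ∧ j = 0) := by
      constructor
      · rintro ⟨a, b, _⟩; exact ⟨by omega, a⟩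
      · rintro ⟨a, b⟩; exact ⟨b, by omega, by omega⟩
    rw [e1, e2]
    simp only [e3]
    rw [smul_zero, add_zero]
    by_cases h0 : n + k = 0 ∧ j = 0
    · have hk : (n : ℂ) = -k := by
        rw [eq_neg_iff_add_eq_zero]; exact_mod_cast h0.1
      rw [if_pos h0]
      push_cast
      rw [hk]
      module
    · rw [if_neg h0]
      push_cast
      module
  · have ha : aOpLam d l lam i j 0 = (if j = 0 then lam i else 0) • 1 := by
      rw [aOpLam_eq, Dop_nonpos _ _ _ _ le_rfl, Xop_nonpos _ _ _ _ (by simp)]; simp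
    rw [ha]
    simp
  · have ha : aOpLam d l lam i j k = ((k : ℂ) * l) • Dop d i j k := by
      rw [aOpLam_eq, Xop_nonpos _ _ _ _ (by omega)]; simp [h.ne']
    rw [ha, hc]
    refine (alg_smul _ (Dop d i j k) ((k : ℂ) * l)).trans ?_
    rw [      alg_comm _ _ _ _ _ _ _ _ _ _ (Ln_D d l n i j k h)
      (sumD_D d lam n i j k) (sumX_D d lam (-n) i j k), aOpLam_eq,
      Xop_nonpos _ _ _ (-(n + k)) (by omega), add_comm k n]
    by_cases h0 : n + k = 0
    · obtain rfl : n = -1 := by omega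
      obtain rfl : k = 1 := by omega
      simp [smul_smul, hl, Dop_nonpos]
      split_ifs <;> simp
    · have h1 : ¬ (k = -n) := by omega
      simp only [h0, h1, false_and, and_false, if_false]
      push_cast
      module

/-- commutator relation underlying eq. (4.5) of Theorem 4.3 for `W(λ,0,l)`:
`[L_λ(n), a_{i,j}(k)] = -k·a_{i,j}(n+k)` for all `n ≥ -1`, `i ∈ Fin d`, `j ∈ ℕ`, `k ∈ ℤ`. -/
theorem statement8 (d : ℕ) (hd : 0 < d) (l : ℂ) (hl : l ≠ 0)
    (lam : Fin d → ℂ) (n : ℤ) (hn : -1 ≤ n) (i : Fin d) (j : ℕ) (k : ℤ) :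
    Llam d l lam n * aOpLam d l lam i j k - aOpLam d l lam i j k * Llam d l lam n
      = (-(k : ℂ)) • aOpLam d l lam i j (n + k) := by
  exact Llam_zero d l hl lam n hn i j k
end

section
/- The operators L_λ(n), n ≥ −1, satisfy the Virasoro relations without central term: for all integers m, n ≥ −1, L_λ(m) ∘ L_λ(n) − L_λ(n) ∘ L_λ(m) = (m−n)·L_λ(m+n) as ℂ-linear endomorphisms of R (equation (4.4) of Theorem 4.3 for the module W(λ,0,l)). -/
open MvPolynomial

section Aux

variable {d : ℕ}

section Bracket

variable {A : Type*} [Ring A] [Algebra ℂ A]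

/-- The commutator. -/
def br (x y : A) : A := x * y - y * x

lemma br_def (x y : A) : br x y = x * y - y * x := rfl

lemma br_sub_lie (x y z : A) : br (x - y) z = br x z - br y z := by
  simp only [br]; noncomm_ring

lemma br_lie_lie (x y z : A) : br (br x y) z = br x (br y z) - br y (br x z) := by
  simp only [br]; noncomm_ring

lemma br_lie_skew (x y : A) : -br y x = br x y := by
  simp only [br]; noncomm_ring

lemma br_smul_lie (c : ℂ) (x y : A) : br (c • x) y = c • br x y := by
  simp only [br, smul_mul_assoc, mul_smul_comm, smul_sub]

lemma br_lie_smul (c : ℂ) (x y : A) : br x (c • y) = c • br x y := by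
  simp only [br, smul_mul_assoc, mul_smul_comm, smul_sub]

lemma br_neg_smul (c : ℂ) (x : A) : -(c • x) = (-c) • x := (neg_smul c x).symm

end Bracket

/-- Partner variable, total version. -/
def ptn (k : ℤ) (v : Fin d × ℕ × ℕ+) : Fin d × ℕ × ℕ+ := (v.1, v.2.1, k.toNat.toPNat')

/-- Quadratic summand. -/
noncomputable def T1 (n : ℤ) (v : Fin d × ℕ × ℕ+) (p : MvPolynomial (Fin d × ℕ × ℕ+) ℂ) :
    MvPolynomial (Fin d × ℕ × ℕ+) ℂ :=
  if ((v.2.2 : ℕ) : ℤ) < n then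
    (((n - ((v.2.2 : ℕ) : ℤ)) * ((v.2.2 : ℕ) : ℤ) : ℤ) : ℂ) •
      pderiv (ptn (n - ((v.2.2 : ℕ) : ℤ)) v) (pderiv v p) else 0

/-- First-order summand. -/
noncomputable def T2 (n : ℤ) (v : Fin d × ℕ × ℕ+) (p : MvPolynomial (Fin d × ℕ × ℕ+) ℂ) :
    MvPolynomial (Fin d × ℕ × ℕ+) ℂ :=
  if n < ((v.2.2 : ℕ) : ℤ) then
    (((v.2.2 : ℕ) : ℤ) : ℂ) • (X (ptn (((v.2.2 : ℕ) : ℤ) - n) v) * pderiv v p) else 0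

lemma mk_eq_toPNat (k : ℕ) (h : 0 < k) : (⟨k, h⟩ : ℕ+) = k.toPNat' := by
  apply PNat.eq
  rw [Nat.toPNat'_coe]
  simp [h]

lemma pderiv_mono_zero (e : (Fin d × ℕ × ℕ+) →₀ ℕ) (v : Fin d × ℕ × ℕ+) (h : v ∉ e.support) :
    pderiv v (monomial e (1 : ℂ)) = 0 := by
  rw [pderiv_monomial]
  simp [Finsupp.notMem_support_iff.mp h]

lemma Ln_mono (l : ℂ) (n : ℤ) (e : (Fin d × ℕ × ℕ+) →₀ ℕ) (S : Finset (Fin d × ℕ × ℕ+))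
    (hS : e.support ⊆ S) :
    Ln d l n (monomial e 1) =
      (l / 2) • (∑ v ∈ S, T1 n v (monomial e 1)) + ∑ v ∈ S, T2 n v (monomial e 1) := by
  have h0 : Ln d l n (monomial e 1) = LnMono d l n e := by
    have := (basisMonomials (Fin d × ℕ × ℕ+) ℂ).constr_basis ℂ (LnMono d l n) e
    rw [coe_basisMonomials] at this
    exact this
  have h1 : ∀ v ∈ S, v ∉ e.support → T1 n v (monomial e 1) = 0 := by
    intro v _ hv
    simp [T1, pderiv_mono_zero e v hv]
  have h2 : ∀ v ∈ S, v ∉ e.support → T2 n v (monomial e 1) = 0 := by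
    intro v _ hv
    simp [T2, pderiv_mono_zero e v hv]
  rw [h0, ← Finset.sum_subset hS h1, ← Finset.sum_subset hS h2]
  unfold LnMono
  refine congrArg₂ (· + ·) (congrArg (fun z => (l / 2) • z) ?_) ?_
  · refine Finset.sum_congr rfl fun v _ => ?_
    unfold T1 ptn
    by_cases h : ((v.2.2 : ℕ) : ℤ) < n
    · rw [dif_pos h, if_pos h, mk_eq_toPNat]
    · rw [dif_neg h, if_neg h]
  · refine Finset.sum_congr rfl fun v _ => ?_
    unfold T2 ptn
    by_cases h : n < ((v.2.2 : ℕ) : ℤ)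
    · rw [dif_pos h, if_pos h, mk_eq_toPNat]
    · rw [dif_neg h, if_neg h]

lemma pderiv_X_mul' (u w : Fin d × ℕ × ℕ+) (p : MvPolynomial (Fin d × ℕ × ℕ+) ℂ) :
    pderiv u (X w * p) = X w * pderiv u p + if u = w then p else 0 := by
  rw [pderiv_mul, pderiv_X]
  by_cases h : u = w
  · subst h; simp; ring
  · simp [h, Pi.single_apply, Ne.symm h]

lemma ptn_eq_iff (n : ℤ) (v w : Fin d × ℕ × ℕ+) (hv : ((v.2.2 : ℕ) : ℤ) < n) :
    ptn (n - ((v.2.2 : ℕ) : ℤ)) v = w ↔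
      (((w.2.2 : ℕ) : ℤ) < n ∧ v = ptn (n - ((w.2.2 : ℕ) : ℤ)) w) := by
  obtain ⟨a, b, c⟩ := v
  obtain ⟨a', b', c'⟩ := w
  have hc := c.pos
  have hc' := c'.pos
  simp only [ptn, Prod.mk.injEq, ← PNat.coe_inj, Nat.toPNat'_coe] at *
  constructor
  · rintro ⟨h1, h2, h3⟩
    split_ifs at h3 with h
    · have h4 : (c' : ℤ) < n := by omega
      refine ⟨h4, h1, h2, ?_⟩
      rw [if_pos (by omega)]; omega
    · omega
  · rintro ⟨h0, h1, h2, h3⟩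
    refine ⟨h1, h2, ?_⟩
    split_ifs at h3 ⊢ <;> omega

lemma T1_X (n : ℤ) (v w : Fin d × ℕ × ℕ+) (p : MvPolynomial (Fin d × ℕ × ℕ+) ℂ) :
    T1 n v (X w * p) = X w * T1 n v p
      + (if v = w then (if ((w.2.2 : ℕ) : ℤ) < n then
          (((n - ((w.2.2 : ℕ) : ℤ)) * ((w.2.2 : ℕ) : ℤ) : ℤ) : ℂ) •
            pderiv (ptn (n - ((w.2.2 : ℕ) : ℤ)) w) p else 0) else 0)
      + (if v = ptn (n - ((w.2.2 : ℕ) : ℤ)) w then (if ((w.2.2 : ℕ) : ℤ) < n then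
          (((n - ((w.2.2 : ℕ) : ℤ)) * ((w.2.2 : ℕ) : ℤ) : ℤ) : ℂ) •
            pderiv (ptn (n - ((w.2.2 : ℕ) : ℤ)) w) p else 0) else 0) := by
  unfold T1
  by_cases hv : ((v.2.2 : ℕ) : ℤ) < n
  · simp only [hv, if_true]
    have e1 : (((n - ((v.2.2 : ℕ) : ℤ)) * ((v.2.2 : ℕ) : ℤ) : ℤ) : ℂ) •
          pderiv (ptn (n - ((v.2.2 : ℕ) : ℤ)) v) (if v = w then p else 0) =
        (if v = w then (if ((w.2.2 : ℕ) : ℤ) < n then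
          (((n - ((w.2.2 : ℕ) : ℤ)) * ((w.2.2 : ℕ) : ℤ) : ℤ) : ℂ) •
            pderiv (ptn (n - ((w.2.2 : ℕ) : ℤ)) w) p else 0) else 0) := by
      by_cases h : v = w
      · subst h; rw [if_pos rfl, if_pos rfl, if_pos hv]
      · rw [if_neg h, if_neg h, map_zero, smul_zero]
    have e2 : (((n - ((v.2.2 : ℕ) : ℤ)) * ((v.2.2 : ℕ) : ℤ) : ℤ) : ℂ) •
          (if ptn (n - ((v.2.2 : ℕ) : ℤ)) v = w then pderiv v p else 0) =
        (if v = ptn (n - ((w.2.2 : ℕ) : ℤ)) w then (if ((w.2.2 : ℕ) : ℤ) < n then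
          (((n - ((w.2.2 : ℕ) : ℤ)) * ((w.2.2 : ℕ) : ℤ) : ℤ) : ℂ) •
            pderiv (ptn (n - ((w.2.2 : ℕ) : ℤ)) w) p else 0) else 0) := by
      have := ptn_eq_iff n v w hv
      by_cases h : ptn (n - ((v.2.2 : ℕ) : ℤ)) v = w
      · obtain ⟨h1, h2⟩ := this.mp h
        rw [if_pos h, if_pos h2, if_pos h1, ← h2]
        have h3 : ((v.2.2 : ℕ) : ℤ) = n - ((w.2.2 : ℕ) : ℤ) := by
          rw [h2]; simp only [ptn, Nat.toPNat'_coe]; split_ifs <;> omega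
        rw [h3, show (n - (n - ((w.2.2 : ℕ) : ℤ))) * (n - ((w.2.2 : ℕ) : ℤ)) =
          (n - ((w.2.2 : ℕ) : ℤ)) * ((w.2.2 : ℕ) : ℤ) by ring]
      · rw [if_neg h]
        by_cases h1 : ((w.2.2 : ℕ) : ℤ) < n
        · rw [if_neg (fun h2 => h (this.mpr ⟨h1, h2⟩)), smul_zero]
        · simp [h1]
    rw [← e1, ← e2, pderiv_X_mul', map_add, pderiv_X_mul']
    simp only [smul_eq_C_mul]
    ring
  · simp only [hv, if_false]
    by_cases h1 : ((w.2.2 : ℕ) : ℤ) < n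
    · have hvw : v ≠ w := by rintro rfl; exact hv h1
      have h2 : v ≠ ptn (n - ((w.2.2 : ℕ) : ℤ)) w := by
        rintro rfl
        apply hv
        have := w.2.2.pos
        simp only [ptn, Nat.toPNat'_coe]; split_ifs <;> omega
      simp [hvw, h2]
    · simp [h1]

lemma T2_X (n : ℤ) (v w : Fin d × ℕ × ℕ+) (p : MvPolynomial (Fin d × ℕ × ℕ+) ℂ) :
    T2 n v (X w * p) = X w * T2 n v p
      + (if v = w then (if n < ((w.2.2 : ℕ) : ℤ) then
          (((w.2.2 : ℕ) : ℤ) : ℂ) • (X (ptn (((w.2.2 : ℕ) : ℤ) - n) w) * p) else 0) else 0) := by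
  unfold T2
  by_cases hv : n < ((v.2.2 : ℕ) : ℤ)
  · simp only [hv, if_true]
    rw [pderiv_X_mul']
    by_cases h : v = w
    · subst h
      simp only [hv, if_true, smul_eq_C_mul]
      ring
    · simp only [h, if_false, add_zero, smul_eq_C_mul]
      ring
  · by_cases h : v = w
    · subst h; simp [hv]
    · simp [h, hv]

lemma Ln_X_s9 (l : ℂ) (n : ℤ) (w : Fin d × ℕ × ℕ+) (p : MvPolynomial (Fin d × ℕ × ℕ+) ℂ) :
    Ln d l n (X w * p) = X w * Ln d l n p
      + (if ((w.2.2 : ℕ) : ℤ) < n then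
          (l * ((n - ((w.2.2 : ℕ) : ℤ)) * ((w.2.2 : ℕ) : ℤ) : ℤ) : ℂ) •
            pderiv (ptn (n - ((w.2.2 : ℕ) : ℤ)) w) p else 0)
      + (if n < ((w.2.2 : ℕ) : ℤ) then
          (((w.2.2 : ℕ) : ℤ) : ℂ) • (X (ptn (((w.2.2 : ℕ) : ℤ) - n) w) * p) else 0) := by
  induction p using MvPolynomial.induction_on' with
  | monomial e a =>
    have hm : monomial e a = a • (monomial e (1 : ℂ)) := by
      rw [smul_monomial]; simp
    have key : ∀ p, p = monomial e (1 : ℂ) → Ln d l n (X w * p) = X w * Ln d l n p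
      + (if ((w.2.2 : ℕ) : ℤ) < n then
          (l * ((n - ((w.2.2 : ℕ) : ℤ)) * ((w.2.2 : ℕ) : ℤ) : ℤ) : ℂ) •
            pderiv (ptn (n - ((w.2.2 : ℕ) : ℤ)) w) p else 0)
      + (if n < ((w.2.2 : ℕ) : ℤ) then
          (((w.2.2 : ℕ) : ℤ) : ℂ) • (X (ptn (((w.2.2 : ℕ) : ℤ) - n) w) * p) else 0) := by
      intro p hp
      classical
      let S : Finset (Fin d × ℕ × ℕ+) :=
        insert w (insert (ptn (n - ((w.2.2 : ℕ) : ℤ)) w) (e + Finsupp.single w 1).support)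
      have hw : w ∈ S := by simp [S]
      have hw' : ptn (n - ((w.2.2 : ℕ) : ℤ)) w ∈ S := by simp [S]
      have hS1 : (e + Finsupp.single w 1).support ⊆ S := by
        intro v hv; simp only [S, Finset.mem_insert]; tauto
      have hS2 : e.support ⊆ S := by
        refine subset_trans ?_ hS1
        intro v hv
        simp only [Finsupp.mem_support_iff, Finsupp.add_apply] at hv ⊢
        omega
      have hx : X w * p = monomial (e + Finsupp.single w 1) (1 : ℂ) := by
        rw [hp, X, monomial_mul, add_comm, one_mul]
      have l1 := Ln_mono l n _ S hS1
      have l2 := Ln_mono l n _ S hS2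
      rw [← hx] at l1
      rw [← hp] at l2
      rw [l1, l2]
      simp only [T1_X, T2_X, Finset.sum_add_distrib, Finset.sum_ite_eq', hw, hw', if_true,
        ← Finset.mul_sum]
      split_ifs <;> simp only [smul_eq_C_mul, C_mul, add_zero, mul_add]
      all_goals
        have h2 : (C l : MvPolynomial (Fin d × ℕ × ℕ+) ℂ) = C (l / 2) + C (l / 2) := by
          rw [← C_add]; congr 1; ring
        try rw [h2]
        ring
    rw [hm]
    have := congrArg (a • ·) (key _ rfl)
    simp only [mul_smul_comm, map_smul, smul_add, smul_ite, smul_zero] at this ⊢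
    rw [this]
    rw [Derivation.map_smul]
    simp only [smul_comm a]
  | add p q hp hq =>
    rw [mul_add, map_add, hp, hq, map_add]
    split_ifs <;> simp only [map_add, mul_add, smul_add, add_zero] <;> abel

lemma Ln_one (l : ℂ) (n : ℤ) : Ln d l n 1 = 0 := by
  have := Ln_mono (d := d) l n 0 ∅ (by simp)
  simpa using this

lemma aOp_pos (l : ℂ) (lam : Fin d → ℂ) (i : Fin d) (j : ℕ) (k : ℤ) (hk : 0 < k)
    (p : MvPolynomial (Fin d × ℕ × ℕ+) ℂ) :
    aOpLam d l lam i j k p = ((k : ℂ) * l) • pderiv (i, j, k.toNat.toPNat') p := by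
  unfold aOpLam
  rw [dif_pos hk, mk_eq_toPNat]
  rfl

lemma aOp_zero (l : ℂ) (lam : Fin d → ℂ) (i : Fin d) (j : ℕ)
    (p : MvPolynomial (Fin d × ℕ × ℕ+) ℂ) :
    aOpLam d l lam i j 0 p = (if j = 0 then lam i else 0) • p := by
  unfold aOpLam
  rw [dif_neg (by omega), dif_pos rfl]
  rfl

lemma aOp_neg (l : ℂ) (lam : Fin d → ℂ) (i : Fin d) (j : ℕ) (k : ℤ) (hk : k < 0)
    (p : MvPolynomial (Fin d × ℕ × ℕ+) ℂ) :
    aOpLam d l lam i j k p = X (i, j, (-k).toNat.toPNat') * p := by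
  unfold aOpLam
  rw [dif_neg (by omega), dif_neg (by omega), mk_eq_toPNat]
  rfl

lemma Llam_pos (l : ℂ) (lam : Fin d → ℂ) (n : ℤ) (hn : 0 < n)
    (p : MvPolynomial (Fin d × ℕ × ℕ+) ℂ) :
    Llam d l lam n p = Ln d l n p +
      (n : ℂ) • ∑ i : Fin d, lam i • pderiv (i, 0, n.toNat.toPNat') p := by
  unfold Llam
  rw [dif_pos hn]
  simp only [mk_eq_toPNat, LinearMap.add_apply, LinearMap.smul_apply, LinearMap.sum_apply]
  rfl

lemma Llam_zero_s9 (l : ℂ) (lam : Fin d → ℂ) (p : MvPolynomial (Fin d × ℕ × ℕ+) ℂ) :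
    Llam d l lam 0 p = Ln d l 0 p + ((∑ i : Fin d, lam i ^ 2) / (2 * l)) • p := by
  simp [Llam]

lemma Llam_neg (l : ℂ) (lam : Fin d → ℂ) (n : ℤ) (hn : n < 0)
    (p : MvPolynomial (Fin d × ℕ × ℕ+) ℂ) :
    Llam d l lam n p = Ln d l n p + l⁻¹ • ∑ i : Fin d, lam i • (X (i, 0, 1) * p) := by
  unfold Llam
  rw [dif_neg (by omega), dif_neg (by omega)]
  simp only [LinearMap.add_apply, LinearMap.smul_apply, LinearMap.sum_apply]
  rfl

lemma Llam_X (l : ℂ) (lam : Fin d → ℂ) (n : ℤ) (w : Fin d × ℕ × ℕ+)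
    (p : MvPolynomial (Fin d × ℕ × ℕ+) ℂ) :
    Llam d l lam n (X w * p) = X w * Llam d l lam n p
      + (((w.2.2 : ℕ) : ℤ) : ℂ) • aOpLam d l lam w.1 w.2.1 (n - ((w.2.2 : ℕ) : ℤ)) p := by
  have hL := Ln_X_s9 l n w p
  have hwp := w.2.2.pos
  obtain hn | rfl | hn := lt_trichotomy n 0
  · rw [Llam_neg _ _ _ hn, Llam_neg _ _ _ hn, aOp_neg _ _ _ _ _ (by omega), hL, if_neg (by omega),
      if_pos (by omega), neg_sub]
    simp only [ptn, smul_eq_C_mul, mul_add, Finset.mul_sum]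
    have : ∀ i, C l⁻¹ * (C (lam i) * (X (i, 0, 1) * (X w * p))) =
      X w * (C l⁻¹ * (C (lam i) * (X (i, 0, 1) * p))) := by intro i; ring
    simp only [this]
    ring
  · rw [Llam_zero_s9, Llam_zero_s9, aOp_neg _ _ _ _ _ (by omega), hL, if_neg (by omega),
      if_pos (by omega), neg_sub]
    simp only [ptn, smul_eq_C_mul]
    ring
  · rw [Llam_pos _ _ _ hn, Llam_pos _ _ _ hn, hL]
    simp only [pderiv_X_mul', smul_add, Finset.sum_add_distrib, mul_add, mul_smul_comm,
      Finset.mul_sum]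
    have key : (if ((w.2.2 : ℕ) : ℤ) < n then
          (l * ((n - ((w.2.2 : ℕ) : ℤ)) * ((w.2.2 : ℕ) : ℤ) : ℤ) : ℂ) •
            pderiv (ptn (n - ((w.2.2 : ℕ) : ℤ)) w) p else 0)
      + (if n < ((w.2.2 : ℕ) : ℤ) then
          (((w.2.2 : ℕ) : ℤ) : ℂ) • (X (ptn (((w.2.2 : ℕ) : ℤ) - n) w) * p) else 0)
      + (n : ℂ) • ∑ i : Fin d, lam i • (if (i, 0, n.toNat.toPNat') = w then p else 0)
      = (((w.2.2 : ℕ) : ℤ) : ℂ) • aOpLam d l lam w.1 w.2.1 (n - ((w.2.2 : ℕ) : ℤ)) p := by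
      obtain ⟨a, b, c⟩ := w
      simp only at *
      obtain h | h | h := lt_trichotomy n ((c : ℕ) : ℤ)
      · have : n.toNat.toPNat' ≠ c := by
          intro h'; rw [← PNat.coe_inj, Nat.toPNat'_coe] at h'; split_ifs at h' <;> omega
        rw [if_neg (by omega), if_pos h, aOp_neg _ _ _ _ _ (by omega)]
        simp [this, ptn]
      · have : n.toNat.toPNat' = c := by
          rw [← PNat.coe_inj, Nat.toPNat'_coe]; split_ifs <;> omega
        rw [if_neg (by omega), if_neg (by omega), ← h, sub_self, aOp_zero]
        simp only [this, Prod.mk.injEq, and_true, smul_ite, smul_zero, zero_add]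
        congr 1
        by_cases hb : b = 0
        · subst hb; simp
        · simp [hb, Ne.symm hb]
      · have : n.toNat.toPNat' ≠ c := by
          intro h'; rw [← PNat.coe_inj, Nat.toPNat'_coe] at h'; split_ifs at h' <;> omega
        rw [if_pos h, if_neg (by omega), aOp_pos _ _ _ _ _ (by omega)]
        simp only [Prod.mk.injEq, this, and_false, if_false, smul_zero, Finset.sum_const_zero,
          add_zero, ptn, smul_smul]
        congr 1
        push_cast
        ring
    rw [← key]
    abel

lemma end_eq_zero (E : Module.End ℂ (MvPolynomial (Fin d × ℕ × ℕ+) ℂ))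
    (hX : ∀ w p, E (X w * p) = X w * E p) (h1 : E 1 = 0) : E = 0 := by
  ext1 e
  refine LinearMap.ext fun a => ?_
  simp only [LinearMap.comp_apply, LinearMap.zero_apply]
  have : ∀ p, E p = 0 := by
    intro p
    induction p using MvPolynomial.induction_on with
    | C a => rw [← mul_one (C a), ← smul_eq_C_mul, map_smul, h1, smul_zero]
    | add p q hp hq => rw [map_add, hp, hq, add_zero]
    | mul_X p w hp => rw [mul_comm, hX, hp, mul_zero]
  exact this _

lemma aOp_comm_neg (l : ℂ) (lam : Fin d → ℂ) (i i' : Fin d) (j j' : ℕ) (k k' : ℤ) (hk' : k' < 0) :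
    br (aOpLam d l lam i j k) (aOpLam d l lam i' j' k') =
      (if i = i' ∧ j = j' ∧ k + k' = 0 then (k : ℂ) * l else 0) • 1 := by
  refine LinearMap.ext fun p => ?_
  simp only [br_def, LinearMap.sub_apply, Module.End.mul_apply, LinearMap.smul_apply,
    Module.End.one_apply, aOp_neg l lam i' j' k' hk']
  obtain h | rfl | h := lt_trichotomy k 0
  · rw [aOp_neg _ _ _ _ _ h, aOp_neg _ _ _ _ _ h, if_neg (by omega), zero_smul]
    ring
  · rw [aOp_zero l lam i j, aOp_zero l lam i j, Int.cast_zero, zero_mul, ite_self, zero_smul,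
      mul_smul_comm, sub_self]
  · rw [aOp_pos _ _ _ _ _ h, aOp_pos _ _ _ _ _ h, pderiv_X_mul', smul_add, mul_smul_comm,
      add_sub_cancel_left]
    have : (i, j, k.toNat.toPNat') = (i', j', (-k').toNat.toPNat') ↔
        (i = i' ∧ j = j' ∧ k + k' = 0) := by
      simp only [Prod.mk.injEq, ← PNat.coe_inj, Nat.toPNat'_coe]
      rw [if_pos (by omega), if_pos (by omega)]
      constructor
      · rintro ⟨h1, h2, h3⟩; exact ⟨h1, h2, by omega⟩
      · rintro ⟨h1, h2, h3⟩; exact ⟨h1, h2, by omega⟩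
    simp only [this]
    split_ifs <;> simp

lemma pderiv_comm' (u v : Fin d × ℕ × ℕ+) (p : MvPolynomial (Fin d × ℕ × ℕ+) ℂ) :
    pderiv u (pderiv v p) = pderiv v (pderiv u p) := by
  have := LinearMap.congr_fun (end_eq_zero ((pderiv u).toLinearMap * (pderiv v).toLinearMap
    - (pderiv v).toLinearMap * (pderiv u).toLinearMap :
      Module.End ℂ (MvPolynomial (Fin d × ℕ × ℕ+) ℂ)) ?_ ?_) p
  · simpa [sub_eq_zero] using this
  · intro w p
    change pderiv u (pderiv v (X w * p)) - pderiv v (pderiv u (X w * p)) =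
      X w * (pderiv u (pderiv v p) - pderiv v (pderiv u p))
    simp only [pderiv_X_mul', map_add]
    have h : ∀ (a b : Fin d × ℕ × ℕ+), pderiv a (if b = w then p else 0) =
        if b = w then pderiv a p else 0 := by
      intro a b; split_ifs <;> simp
    rw [h, h]
    ring
  · simp

lemma aOp_comm (l : ℂ) (lam : Fin d → ℂ) (i i' : Fin d) (j j' : ℕ) (k k' : ℤ) :
    br (aOpLam d l lam i j k) (aOpLam d l lam i' j' k') =
      (if i = i' ∧ j = j' ∧ k + k' = 0 then (k : ℂ) * l else 0) • 1 := by
  by_cases hk' : k' < 0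
  · exact aOp_comm_neg l lam i i' j j' k k' hk'
  by_cases hk : k < 0
  · rw [← br_lie_skew, aOp_comm_neg l lam i' i j' j k' k hk]
    by_cases h : i = i' ∧ j = j' ∧ k + k' = 0
    · obtain ⟨rfl, rfl, h⟩ := h
      have : k' = -k := by omega
      subst this
      rw [if_pos ⟨rfl, rfl, by omega⟩, if_pos ⟨rfl, rfl, by omega⟩,
        show (k : ℂ) * l = -(((-k : ℤ) : ℂ) * l) by push_cast; ring]
      exact br_neg_smul _ _
    · rw [if_neg h, if_neg (fun h' => h ⟨h'.1.symm, h'.2.1.symm, by omega⟩)]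
      simp
  have hz : (if i = i' ∧ j = j' ∧ k + k' = 0 then (k : ℂ) * l else 0) = 0 := by
    split_ifs with h
    · have : k = 0 := by omega
      simp [this]
    · rfl
  rw [hz, zero_smul]
  refine LinearMap.ext fun p => ?_
  simp only [br_def, LinearMap.sub_apply, Module.End.mul_apply, LinearMap.zero_apply]
  obtain rfl | h : k = 0 ∨ 0 < k := by omega
  · rw [aOp_zero l lam i j, aOp_zero l lam i j, map_smul, sub_self]
  obtain rfl | h' : k' = 0 ∨ 0 < k' := by omega
  · rw [aOp_zero l lam i' j', aOp_zero l lam i' j', map_smul, sub_self]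
  simp only [aOp_pos _ _ _ _ _ h, aOp_pos _ _ _ _ _ h', Derivation.map_smul]
  rw [pderiv_comm', smul_comm, sub_self]

lemma aOp_toX (l : ℂ) (lam : Fin d → ℂ) (w : Fin d × ℕ × ℕ+)
    (p : MvPolynomial (Fin d × ℕ × ℕ+) ℂ) :
    aOpLam d l lam w.1 w.2.1 (-((w.2.2 : ℕ) : ℤ)) p = X w * p := by
  rw [aOp_neg _ _ _ _ _ (by have := w.2.2.pos; omega)]
  simp

lemma end_eq_zero' (l : ℂ) (lam : Fin d → ℂ) (E : Module.End ℂ (MvPolynomial (Fin d × ℕ × ℕ+) ℂ))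
    (hX : ∀ i j k, k < 0 → br (E) (aOpLam d l lam i j k) = 0) (h1 : E 1 = 0) : E = 0 := by
  refine end_eq_zero E (fun w p => ?_) h1
  have := LinearMap.congr_fun (hX w.1 w.2.1 (-((w.2.2 : ℕ) : ℤ))
    (by have := w.2.2.pos; omega)) p
  simpa only [br_def, LinearMap.sub_apply, Module.End.mul_apply, LinearMap.zero_apply,
    aOp_toX, sub_eq_zero] using this

lemma Llam_comm_neg (l : ℂ) (lam : Fin d → ℂ) (n : ℤ) (i : Fin d) (j : ℕ) (k : ℤ) (hk : k < 0) :
    br (Llam d l lam n) (aOpLam d l lam i j k) = (-k : ℂ) • aOpLam d l lam i j (n + k) := by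
  refine LinearMap.ext fun p => ?_
  simp only [br_def, LinearMap.sub_apply, Module.End.mul_apply, LinearMap.smul_apply]
  rw [aOp_neg _ _ _ _ _ hk, aOp_neg _ _ _ _ _ hk, Llam_X, add_sub_cancel_left]
  have : (((-k).toNat.toPNat' : ℕ) : ℤ) = -k := by
    rw [Nat.toPNat'_coe, if_pos (by omega)]; omega
  simp only [this, sub_neg_eq_add, Int.cast_neg]

lemma Llam_one_pos (l : ℂ) (lam : Fin d → ℂ) (n : ℤ) (hn : 0 < n) : Llam d l lam n 1 = 0 := by
  rw [Llam_pos _ _ _ hn, Ln_one]; simp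

lemma Llam_one_neg (l : ℂ) (lam : Fin d → ℂ) : Llam d l lam (-1) 1 =
    l⁻¹ • ∑ i : Fin d, lam i • X (i, 0, 1) := by
  rw [Llam_neg _ _ _ (by omega), Ln_one]; simp

lemma Llam_one_zero (l : ℂ) (lam : Fin d → ℂ) : Llam d l lam 0 1 =
    ((∑ i : Fin d, lam i ^ 2) / (2 * l)) • 1 := by
  rw [Llam_zero_s9, Ln_one, zero_add]

lemma aOp_one_pos (l : ℂ) (lam : Fin d → ℂ) (i : Fin d) (j : ℕ) (k : ℤ) (hk : 0 < k) :
    aOpLam d l lam i j k 1 = 0 := by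
  rw [aOp_pos _ _ _ _ _ hk]; simp

lemma Llam_comm (l : ℂ) (hl : l ≠ 0) (lam : Fin d → ℂ) (n : ℤ) (hn : -1 ≤ n)
    (i : Fin d) (j : ℕ) (k : ℤ) :
    br (Llam d l lam n) (aOpLam d l lam i j k) = (-k : ℂ) • aOpLam d l lam i j (n + k) := by
  obtain hk | rfl | hk := lt_trichotomy k 0
  · exact Llam_comm_neg l lam n i j k hk
  · refine LinearMap.ext fun p => ?_
    simp only [br_def, LinearMap.sub_apply, Module.End.mul_apply, LinearMap.smul_apply]
    rw [aOp_zero, aOp_zero, map_smul]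
    simp
  rw [← sub_eq_zero]
  apply end_eq_zero' l lam
  · intro i' j' k' hk'
    rw [br_sub_lie, br_lie_lie, Llam_comm_neg l lam n i' j' k' hk', br_smul_lie, br_lie_smul, aOp_comm,
      aOp_comm, aOp_comm, br_lie_smul]
    have h0 : br (Llam d l lam n) ((1 : Module.End ℂ (MvPolynomial (Fin d × ℕ × ℕ+) ℂ))) = 0 := by
      simp [br_def]
    rw [h0, smul_zero, zero_sub, smul_smul, smul_smul, ← neg_smul, ← sub_smul]
    by_cases h : i = i' ∧ j = j' ∧ k + (n + k') = 0
    · rw [if_pos h, if_pos ⟨h.1, h.2.1, by omega⟩]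
      have h3 : (k' : ℂ) = -((n : ℂ) + k) := by
        have : k' = -(n + k) := by omega
        rw [this]; push_cast; ring
      convert zero_smul ℂ _
      rw [h3]; push_cast; ring
    · rw [if_neg h, if_neg (fun h' => h ⟨h'.1, h'.2.1, by omega⟩)]
      simp
  · simp only [br_def, LinearMap.sub_apply, Module.End.mul_apply, LinearMap.smul_apply,
      aOp_one_pos l lam i j k hk, map_zero, zero_sub]
    obtain rfl | rfl | hn' : n = -1 ∨ n = 0 ∨ 0 < n := by omega
    · rw [Llam_one_neg, aOp_pos _ _ _ _ _ hk]
      simp only [Derivation.map_smul, map_sum, pderiv_X]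
      obtain rfl | hk1 : k = 1 ∨ 1 < k := by omega
      · rw [show (-1 + 1 : ℤ) = 0 by rfl, aOp_zero]
        have h1 : (Int.toNat 1).toPNat' = 1 := rfl
        rw [h1]
        by_cases hj : j = 0
        · subst hj
          simp [Pi.single_apply, smul_smul, hl]
        · simp [Pi.single_apply, hj, Ne.symm hj]
      · have h1 : (1 : ℕ+) ≠ k.toNat.toPNat' := by
          intro h'; rw [← PNat.coe_inj, Nat.toPNat'_coe] at h'
          rw [if_pos (by omega)] at h'
          simp at h'; omega
        rw [aOp_one_pos _ _ _ _ _ (by omega)]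
        simp [Pi.single_apply, h1, Ne.symm h1]
    · rw [Llam_one_zero, map_smul, zero_add, aOp_one_pos _ _ _ _ _ hk]; simp
    · rw [Llam_one_pos _ _ _ hn', aOp_one_pos _ _ _ _ _ (by omega)]; simp

lemma main_lt (l : ℂ) (hl : l ≠ 0) (lam : Fin d → ℂ) (m n : ℤ) (hmn : n < m) (hn : -1 ≤ n) :
    br (Llam d l lam m) (Llam d l lam n) = ((m - n : ℤ) : ℂ) • Llam d l lam (m + n) := by
  rw [← sub_eq_zero]
  apply end_eq_zero' l lam
  · intro i j k hk
    rw [br_sub_lie, br_lie_lie, br_smul_lie]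
    simp only [Llam_comm l hl lam m (by omega), Llam_comm l hl lam n hn,
      Llam_comm l hl lam (m + n) (by omega), br_lie_smul, smul_smul]
    rw [show n + (m + k) = m + n + k by ring, show m + (n + k) = m + n + k by ring,
      ← sub_smul, ← sub_smul]
    convert zero_smul ℂ _
    push_cast
    ring
  · simp only [br_def, LinearMap.sub_apply, Module.End.mul_apply, LinearMap.smul_apply]
    obtain rfl | hn' : n = -1 ∨ 0 ≤ n := by omega
    · have hX1 : ∀ i : Fin d, Llam d l lam m (X (i, 0, 1)) = X (i, 0, 1) * Llam d l lam m 1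
          + aOpLam d l lam i 0 (m - 1) 1 := by
        intro i
        have := Llam_X l lam m (i, 0, 1) 1
        simpa using this
      rw [Llam_one_neg]
      simp only [map_smul, map_sum, hX1]
      obtain rfl | rfl | hm : m = 0 ∨ m = 1 ∨ 1 < m := by omega
      · rw [Llam_one_zero, map_smul, show (0 + -1 : ℤ) = -1 by rfl, Llam_one_neg]
        simp only [aOp_neg l lam _ _ (0 - 1 : ℤ) (by omega)]
        have h1 : (-(0 - 1) : ℤ).toNat.toPNat' = 1 := rfl
        rw [h1]
        simp only [mul_one, mul_smul_comm, smul_add, Finset.sum_add_distrib, Finset.smul_sum]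
        simp only [smul_smul]
        generalize (∑ i : Fin d, lam i ^ 2) / (2 * l) = mu
        simp [mul_comm, mul_left_comm, mul_assoc]
      · rw [Llam_one_pos _ _ _ (by omega), show (1 + -1 : ℤ) = 0 by rfl, Llam_one_zero,
          show (1 - 1 : ℤ) = 0 by rfl]
        simp only [aOp_zero, mul_zero, zero_add, map_zero, sub_zero, if_true, smul_smul,
          ← Finset.sum_smul, ← sub_smul]
        convert zero_smul ℂ _
        simp only [← pow_two]
        field_simp
        push_cast
        ring
      · rw [Llam_one_pos _ _ _ (by omega), Llam_one_pos _ _ _ (by omega)]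
        simp [aOp_one_pos l lam _ _ (m - 1) (by omega)]
    · rw [Llam_one_pos _ _ m (by omega), Llam_one_pos _ _ (m + n) (by omega)]
      obtain rfl | h : n = 0 ∨ 0 < n := by omega
      · rw [Llam_one_zero, map_smul, Llam_one_pos _ _ m (by omega)]; simp
      · rw [Llam_one_pos _ _ n h]; simp

end Aux

/-- eq. (4.4) of Theorem 4.3 for `W(λ,0,l)`: the operators `L_λ(n)`, `n ≥ -1`,
satisfy the Virasoro relations without central term:
`[L_λ(m), L_λ(n)] = (m-n)·L_λ(m+n)`. -/
theorem statement9 (d : ℕ) (hd : 0 < d) (l : ℂ) (hl : l ≠ 0)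
    (lam : Fin d → ℂ) (m n : ℤ) (hm : -1 ≤ m) (hn : -1 ≤ n) :
    Llam d l lam m * Llam d l lam n - Llam d l lam n * Llam d l lam m
      = ((m - n : ℤ) : ℂ) • Llam d l lam (m + n) := by
  rw [← br_def]
  obtain h | rfl | h := lt_trichotomy n m
  · exact main_lt l hl lam m n h hn
  · simp [br_def]
  · rw [← br_lie_skew, main_lt l hl lam n m h hm, add_comm n m,
      show ((m - n : ℤ) : ℂ) = -((n - m : ℤ) : ℂ) by push_cast; ring]
    exact br_neg_smul _ _
end
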